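/- arXiv:1408.6445 — 2 statements merged into one kernel-verified Lean document; each statement's English description precedes it below -/
import Mathlib

section
/- Let k be a field of characteristic 0 and n a positive integer. The symplectic group Sp_{2n}(k) = {T ∈ GL_{2n}(k) : ω(Tu, Tv) = ω(u, v) for all u, v ∈ k^{2n}} is generated by the following three families of 2n × 2n block matrices (blocks of size n × n): (i) [[A, 0],[0, (Aᵀ)⁻¹]] for A ∈ GL_n(k); (ii) [[I_n, 0],[B, I_n]] for symmetric B ∈ M_n(k); (iii) [[I_n, B],[0, I_n]] for symmetric B ∈ M_n(k). -/
open Matrix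

/-- The standard symplectic bilinear form on `k^{2n} = (Fin n ⊕ Fin n) → k`:
`ω(a, b) = Σ_{i=1}^n (a_i b_{n+i} − a_{n+i} b_i)`. -/
def stdSymplecticForm (k : Type*) [Field k] (n : ℕ) (a b : Fin n ⊕ Fin n → k) : k :=
  ∑ i : Fin n, (a (Sum.inl i) * b (Sum.inr i) - a (Sum.inr i) * b (Sum.inl i))

/-- The three families of block matrices: `[[A, 0],[0, (Aᵀ)⁻¹]]` for `A ∈ GL_n(k)`,
`[[I, 0],[B, I]]` and `[[I, B],[0, I]]` for symmetric `B`. -/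
def sympGenerators (k : Type*) [Field k] (n : ℕ) : Set (GL (Fin n ⊕ Fin n) k) :=
  {T | (∃ A : GL (Fin n) k,
          (T : Matrix (Fin n ⊕ Fin n) (Fin n ⊕ Fin n) k) =
            Matrix.fromBlocks (A : Matrix (Fin n) (Fin n) k) 0 0
              (((A : Matrix (Fin n) (Fin n) k))ᵀ)⁻¹) ∨
       (∃ B : Matrix (Fin n) (Fin n) k, B.IsSymm ∧
          (T : Matrix (Fin n ⊕ Fin n) (Fin n ⊕ Fin n) k) = Matrix.fromBlocks 1 0 B 1) ∨
       (∃ B : Matrix (Fin n) (Fin n) k, B.IsSymm ∧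
          (T : Matrix (Fin n ⊕ Fin n) (Fin n ⊕ Fin n) k) = Matrix.fromBlocks 1 B 0 1)}

section

variable {l k : Type*} [Fintype l] [DecidableEq l] [Field k]

/-- Every square matrix over a field is equivalent to a symmetric idempotent matrix. -/
lemma exists_isUnit_mul_mul_isSymm_isIdempotentElem (C : Matrix l l k) :
    ∃ V U : Matrix l l k, IsUnit V ∧ IsUnit U ∧ (V * C * U).IsSymm ∧
      IsIdempotentElem (V * C * U) := by
  obtain ⟨V, U, s, hV, hU, h⟩ := Matrix.exists_rank_normal_form C
  refine ⟨V, U, hV, hU, ?_, ?_⟩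
  · rw [h]
    exact Matrix.IsSymm.submatrix (by simp [Matrix.IsSymm, fromBlocks_transpose]) s
  · rw [h, IsIdempotentElem, submatrix_mul_equiv, fromBlocks_multiply]
    simp

lemma isUnit_of_mulVec_eq_zero {M : Matrix l l k} (h : ∀ x, M *ᵥ x = 0 → x = 0) : IsUnit M := by
  rw [← Matrix.mulVec_injective_iff_isUnit, ← Matrix.coe_mulVecLin, ← LinearMap.ker_eq_bot,
    Matrix.ker_mulVecLin_eq_bot_iff]
  exact h

/-- If `P` is a symmetric idempotent with `Qᵀ * P = P * Q` and `P`, `Q` have no common kernel,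
then `Q + (P - P * Q) * P` is invertible. -/
lemma isUnit_add_sub_mul {P Q : Matrix l l k} (hP : IsIdempotentElem P) (hQ : Qᵀ * P = P * Q)
    (hker : ∀ x, Q *ᵥ x = 0 → P *ᵥ x = 0 → x = 0) : IsUnit (Q + (P - P * Q) * P) := by
  have hPQP : P * Q * P = P * Q := by rw [← hQ, mul_assoc, hP.eq]
  refine isUnit_of_mulVec_eq_zero fun x hx ↦ ?_
  have hPx : P *ᵥ x = 0 := by
    have : P * (Q + (P - P * Q) * P) = P := by
      rw [sub_mul, hP.eq, hPQP, mul_add, mul_sub, ← mul_assoc, hP.eq, add_sub_cancel]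
    rw [← this, ← mulVec_mulVec, hx, mulVec_zero]
  refine hker x ?_ hPx
  rwa [add_mulVec, ← mulVec_mulVec, hPx, mulVec_zero, add_zero] at hx

lemma exists_isSymm_isUnit_add_mul {A C : Matrix l l k} (hsymm : Aᵀ * C = Cᵀ * A)
    (hker : ∀ x, A *ᵥ x = 0 → C *ᵥ x = 0 → x = 0) :
    ∃ X : Matrix l l k, X.IsSymm ∧ IsUnit (A + X * C) := by
  obtain ⟨V, U, hV, hU, hPs, hPi⟩ := exists_isUnit_mul_mul_isSymm_isIdempotentElem C
  have hVt : IsUnit Vᵀ := V.isUnit_transpose.2 hV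
  obtain ⟨W, hVW⟩ := hVt.exists_right_inv
  have hWV : W * Vᵀ = 1 := mul_eq_one_comm.1 hVW
  have hVWt : V * Wᵀ = 1 := by simpa using congrArg transpose hWV
  have hWVt : Wᵀ * V = 1 := mul_eq_one_comm.1 hVWt
  set P := V * C * U with hP
  set Q := W * A * U with hQ
  have hQP : Qᵀ * P = P * Q := by
    conv_rhs => rw [← hPs.eq]
    calc Qᵀ * P = Uᵀ * Aᵀ * (Wᵀ * V) * C * U := by simp [hP, hQ, mul_assoc]
      _ = Uᵀ * (Aᵀ * C) * U := by rw [hWVt]; simp [mul_assoc]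
      _ = Uᵀ * Cᵀ * (Vᵀ * W) * A * U := by rw [hsymm, hVW]; simp [mul_assoc]
      _ = Pᵀ * Q := by simp [hP, hQ, mul_assoc]
  have hunit : IsUnit (Q + (P - P * Q) * P) := by
    refine isUnit_add_sub_mul hPi hQP fun x hQx hPx ↦ ?_
    have hA : A *ᵥ U *ᵥ x = 0 := by
      have : A * U = Vᵀ * Q := by rw [hQ, ← mul_assoc, ← mul_assoc, hVW, one_mul]
      rw [mulVec_mulVec, this, ← mulVec_mulVec, hQx, mulVec_zero]
    have hC : C *ᵥ U *ᵥ x = 0 := by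
      have : C * U = Wᵀ * P := by rw [hP, ← mul_assoc, ← mul_assoc, hWVt, one_mul]
      rw [mulVec_mulVec, this, ← mulVec_mulVec, hPx, mulVec_zero]
    exact mulVec_injective_iff_isUnit.2 hU (by simpa using hker _ hA hC)
  refine ⟨Vᵀ * (P - P * Q) * V, ?_, ?_⟩
  · have : (P * Q)ᵀ = P * Q := by rw [transpose_mul, hPs.eq, hQP]
    simp [Matrix.IsSymm, hPs.eq, this, mul_assoc]
  · refine (hU.mul_right_iff).1 ?_
    have : (A + Vᵀ * (P - P * Q) * V * C) * U = Vᵀ * (Q + (P - P * Q) * P) := by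
      rw [add_mul, mul_add, hQ, ← mul_assoc Vᵀ, ← mul_assoc Vᵀ, hVW, one_mul, hP]
      simp only [mul_assoc]
    rw [this]
    exact hVt.mul hunit

/-- The standard symplectic form is preserved exactly by the matrices in Mathlib's
symplectic group. -/
lemma forall_stdSymplecticForm_mulVec_iff {n : ℕ} {M : Matrix (Fin n ⊕ Fin n) (Fin n ⊕ Fin n) k} :
    (∀ u v, stdSymplecticForm k n (M *ᵥ u) (M *ᵥ v) = stdSymplecticForm k n u v) ↔
      M ∈ symplecticGroup (Fin n) k := by
  have hform (a b : Fin n ⊕ Fin n → k) :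
      stdSymplecticForm k n a b = -(a ⬝ᵥ (J (Fin n) k *ᵥ b)) := by
    obtain ⟨b₁, b₂, rfl⟩ : ∃ b₁ b₂, b = Sum.elim b₁ b₂ := ⟨_, _, (Sum.elim_comp_inl_inr b).symm⟩
    simp [stdSymplecticForm, J, fromBlocks_mulVec, dotProduct, neg_mulVec, sub_eq_neg_add,
      Finset.sum_add_distrib]
  have hpull (u v : Fin n ⊕ Fin n → k) :
      (M *ᵥ u) ⬝ᵥ (J (Fin n) k *ᵥ (M *ᵥ v)) = u ⬝ᵥ ((Mᵀ * J (Fin n) k * M) *ᵥ v) := by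
    rw [← mulVec_mulVec, ← mulVec_mulVec, dotProduct_mulVec u, vecMul_transpose]
  simp only [hform, neg_inj, hpull, SymplecticGroup.mem_iff']
  refine ⟨fun h ↦ ?_, fun h u v ↦ by rw [h]⟩
  ext i j
  simpa using h (Pi.single i 1) (Pi.single j 1)

lemma mem_symplecticGroup_of_mem_sympGenerators {n : ℕ} {T : GL (Fin n ⊕ Fin n) k}
    (hT : T ∈ sympGenerators k n) :
    (T : Matrix (Fin n ⊕ Fin n) (Fin n ⊕ Fin n) k) ∈ symplecticGroup (Fin n) k := by
  rcases hT with ⟨A, h⟩ | ⟨B, hB, h⟩ | ⟨B, hB, h⟩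
  · have hA : IsUnit (A : Matrix (Fin n) (Fin n) k)ᵀ.det := by
      rw [← isUnit_iff_isUnit_det]
      exact Matrix.isUnit_transpose _ |>.2 A.isUnit
    rw [h, SymplecticGroup.fromBlocks_mem_iff]
    simp [mul_nonsing_inv _ hA]
  · rw [h, SymplecticGroup.fromBlocks_mem_iff]
    simp [hB.eq]
  · rw [h, SymplecticGroup.fromBlocks_mem_iff]
    simp [hB.eq]

lemma mem_symplecticGroup_of_mem_closure {n : ℕ} {T : GL (Fin n ⊕ Fin n) k}
    (hT : T ∈ Subgroup.closure (sympGenerators k n)) :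
    (T : Matrix (Fin n ⊕ Fin n) (Fin n ⊕ Fin n) k) ∈ symplecticGroup (Fin n) k := by
  induction hT using Subgroup.closure_induction with
  | mem T hT => exact mem_symplecticGroup_of_mem_sympGenerators hT
  | one => simp
  | mul S T _ _ hS hT => simpa using mul_mem hS hT
  | inv T _ hT =>
    rw [coe_units_inv, ← SymplecticGroup.coe_inv' ⟨_, hT⟩]
    exact Subtype.property _

/-- A symplectic block matrix with invertible upper left block factors as
lower unitriangular, block diagonal, upper unitriangular. -/
lemma fromBlocks_eq_mul_of_mem_symplecticGroup {A B C D : Matrix l l k} (hA : IsUnit A)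
    (h : fromBlocks A B C D ∈ symplecticGroup l k) :
    (C * A⁻¹).IsSymm ∧ (A⁻¹ * B).IsSymm ∧
      fromBlocks A B C D =
        fromBlocks 1 0 (C * A⁻¹) 1 * fromBlocks A 0 0 (Aᵀ)⁻¹ * fromBlocks 1 (A⁻¹ * B) 0 1 := by
  have hdet : IsUnit A.det := (isUnit_iff_isUnit_det _).1 hA
  have hdetT : IsUnit Aᵀ.det := by rwa [det_transpose]
  obtain ⟨hAC, -, hAD⟩ := SymplecticGroup.fromBlocks_mem_iff.1 h
  have hT := SymplecticGroup.transpose_mem h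
  rw [fromBlocks_transpose, SymplecticGroup.fromBlocks_mem_iff] at hT
  have hAB : A * Bᵀ = B * Aᵀ := by simpa using hT.1
  have hCA : Aᵀ⁻¹ * Cᵀ = C * A⁻¹ := by
    rw [← mul_nonsing_inv_cancel_right A Cᵀ hdet, ← hAC, mul_assoc Aᵀ,
      nonsing_inv_mul_cancel_left _ _ hdetT]
  have hBA : Bᵀ * Aᵀ⁻¹ = A⁻¹ * B := by
    rw [← nonsing_inv_mul_cancel_left A Bᵀ hdet, hAB, mul_assoc, mul_assoc,
      mul_nonsing_inv _ hdetT, mul_one]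
  have hD : C * A⁻¹ * B + Aᵀ⁻¹ = D := by
    rw [← nonsing_inv_mul_cancel_left Aᵀ D hdetT, sub_eq_iff_eq_add'.1 hAD, mul_add, mul_one,
      ← mul_assoc, hCA]
  refine ⟨?_, ?_, ?_⟩
  · rw [Matrix.IsSymm, transpose_mul, transpose_nonsing_inv, hCA]
  · rw [Matrix.IsSymm, transpose_mul, transpose_nonsing_inv, hBA]
  · simp [fromBlocks_multiply, nonsing_inv_mul_cancel_right _ _ hdet,
      mul_nonsing_inv_cancel_left _ _ hdet, ← mul_assoc, hD]

/-- The upper unitriangular block matrix `[[I, X], [0, I]]` as an element of `GL`. -/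
def upperUnitriangular (X : Matrix l l k) : GL (l ⊕ l) k where
  val := fromBlocks 1 X 0 1
  inv := fromBlocks 1 (-X) 0 1
  val_inv := by simp [fromBlocks_multiply]
  inv_val := by simp [fromBlocks_multiply]

/-- The lower unitriangular block matrix `[[I, 0], [X, I]]` as an element of `GL`. -/
def lowerUnitriangular (X : Matrix l l k) : GL (l ⊕ l) k where
  val := fromBlocks 1 0 X 1
  inv := fromBlocks 1 0 (-X) 1
  val_inv := by simp [fromBlocks_multiply]
  inv_val := by simp [fromBlocks_multiply]

/-- The block diagonal matrix `[[A, 0], [0, (Aᵀ)⁻¹]]` as an element of `GL`. -/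
noncomputable def blockDiagonalInvTranspose (A : GL l k) : GL (l ⊕ l) k :=
  GeneralLinearGroup.mkOfDetNeZero (fromBlocks (A : Matrix l l k) 0 0 ((A : Matrix l l k)ᵀ)⁻¹) <| by
    have : (A : Matrix l l k).det ≠ 0 := A.det_ne_zero
    simp [det_fromBlocks_zero₂₁, det_nonsing_inv, this]

variable {n : ℕ}

lemma upperUnitriangular_mem_closure {X : Matrix (Fin n) (Fin n) k} (hX : X.IsSymm) :
    upperUnitriangular X ∈ Subgroup.closure (sympGenerators k n) :=
  Subgroup.subset_closure <| .inr <| .inr ⟨X, hX, rfl⟩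

lemma lowerUnitriangular_mem_closure {X : Matrix (Fin n) (Fin n) k} (hX : X.IsSymm) :
    lowerUnitriangular X ∈ Subgroup.closure (sympGenerators k n) :=
  Subgroup.subset_closure <| .inr <| .inl ⟨X, hX, rfl⟩

lemma blockDiagonalInvTranspose_mem_closure (A : GL (Fin n) k) :
    blockDiagonalInvTranspose A ∈ Subgroup.closure (sympGenerators k n) :=
  Subgroup.subset_closure <| .inl ⟨A, rfl⟩

/-- A symplectic matrix with invertible upper left block is a product of generators. -/
lemma mem_closure_of_isUnit_toBlocks₁₁ {T : GL (Fin n ⊕ Fin n) k}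
    (hT : (T : Matrix (Fin n ⊕ Fin n) (Fin n ⊕ Fin n) k) ∈ symplecticGroup (Fin n) k)
    (hA : IsUnit (T : Matrix (Fin n ⊕ Fin n) (Fin n ⊕ Fin n) k).toBlocks₁₁) :
    T ∈ Subgroup.closure (sympGenerators k n) := by
  rw [← fromBlocks_toBlocks T.val] at hT
  obtain ⟨hL, hU, h⟩ := fromBlocks_eq_mul_of_mem_symplecticGroup hA hT
  have hprod : T = lowerUnitriangular _ * blockDiagonalInvTranspose hA.unit *
      upperUnitriangular _ := Units.ext <| (fromBlocks_toBlocks _).symm.trans h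
  rw [hprod]
  exact mul_mem (mul_mem (lowerUnitriangular_mem_closure hL)
    (blockDiagonalInvTranspose_mem_closure _)) (upperUnitriangular_mem_closure hU)

lemma mem_closure_of_mem_symplecticGroup {T : GL (Fin n ⊕ Fin n) k}
    (hT : (T : Matrix (Fin n ⊕ Fin n) (Fin n ⊕ Fin n) k) ∈ symplecticGroup (Fin n) k) :
    T ∈ Subgroup.closure (sympGenerators k n) := by
  obtain ⟨A, B, C, D, hM⟩ : ∃ A B C D, T.val = fromBlocks A B C D :=
    ⟨_, _, _, _, (fromBlocks_toBlocks _).symm⟩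
  obtain ⟨X, hX, hunit⟩ : ∃ X : Matrix (Fin n) (Fin n) k, X.IsSymm ∧ IsUnit (A + X * C) := by
    refine exists_isSymm_isUnit_add_mul (SymplecticGroup.fromBlocks_mem_iff.1 (hM ▸ hT)).1
      fun x hAx hCx ↦ ?_
    have hx : T.val *ᵥ Sum.elim x 0 = T.val *ᵥ Sum.elim 0 0 := by
      simp [hM, fromBlocks_mulVec, hAx, hCx]
    exact (Sum.elim_eq_iff.1 (mulVec_injective_iff_isUnit.2 T.isUnit hx)).1
  have hXmem := upperUnitriangular_mem_closure hX
  refine (Subgroup.mul_mem_cancel_left _ hXmem).1 (mem_closure_of_isUnit_toBlocks₁₁ ?_ ?_)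
  · simpa using mul_mem (mem_symplecticGroup_of_mem_closure hXmem) hT
  · simpa [hM, upperUnitriangular, fromBlocks_multiply] using hunit

end

/-- The symplectic group `Sp_{2n}(k)`, i.e. the set of `T ∈ GL_{2n}(k)` preserving the standard
symplectic form, is generated (as a group) by the three families of block matrices
`[[A, 0],[0, (Aᵀ)⁻¹]]` (`A ∈ GL_n(k)`), `[[I, 0],[B, I]]` and `[[I, B],[0, I]]` (`B` symmetric). -/
theorem symplecticGroup_eq_closure_generators (k : Type*) [Field k] [CharZero k]
    (n : ℕ) (hn : 0 < n) :
    {T : GL (Fin n ⊕ Fin n) k |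
        ∀ u v : Fin n ⊕ Fin n → k,
          stdSymplecticForm k n
              (Matrix.mulVec (T : Matrix (Fin n ⊕ Fin n) (Fin n ⊕ Fin n) k) u)
              (Matrix.mulVec (T : Matrix (Fin n ⊕ Fin n) (Fin n ⊕ Fin n) k) v)
            = stdSymplecticForm k n u v}
      = ↑(Subgroup.closure (sympGenerators k n)) := by
  ext T
  rw [Set.mem_ofPred_eq, forall_stdSymplecticForm_mulVec_iff]
  exact ⟨mem_closure_of_mem_symplecticGroup, mem_symplecticGroup_of_mem_closure⟩
end

section
/- Let C be a monoidal category and let Z(C) denote its Drinfeld center, with forgetful functor F : Z(C) → C. The assignment sending a braiding c on C (a natural family of isomorphisms c_{X,Y} : X ⊗ Y ≅ Y ⊗ X satisfying the hexagon axioms) to the monoidal functor ι_c : C → Z(C), X ↦ (X, c_{−,X}), is a bijection between the set of braidings on C and the set of monoidal functors ι : C → Z(C) whose composite F ∘ ι equals the identity monoidal functor of C. -/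
open CategoryTheory

universe v u

namespace CategoryTheory

open MonoidalCategory Functor.LaxMonoidal

theorem Functor.Monoidal.ext_of_ε_μ {C D : Type*} [Category* C] [Category* D]
    [MonoidalCategory C] [MonoidalCategory D] {F : C ⥤ D} (M N : F.Monoidal)
    (hε : M.ε = N.ε) (hμ : ∀ X Y, M.μ X Y = N.μ X Y) : M = N :=
  toLaxMonoidal_injective F <| LaxMonoidal.ext hε (funext₂ hμ)

namespace Center

variable {C : Type u} [Category.{v} C] [MonoidalCategory C]

/-- The functor `C ⥤ Center C` attached to a family of half-braidings on the objects of `C`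
for which every morphism of `C` is a morphism in the center. -/
def liftOfHalfBraiding (b : ∀ X : C, HalfBraiding X)
    (hb : ∀ {X Y : C} (f : X ⟶ Y) (U : C),
      f ▷ U ≫ ((b Y).β U).hom = ((b X).β U).hom ≫ U ◁ f) : C ⥤ Center C where
  obj X := ⟨X, b X⟩
  map f := ⟨f, hb f⟩

theorem exists_eq_liftOfHalfBraiding (F : C ⥤ Center C) (hF : F ⋙ forget C = 𝟭 C) :
    ∃ b hb, F = liftOfHalfBraiding b hb := by
  obtain ⟨obj, map, map_id, map_comp⟩ := F
  obtain ⟨o, b, rfl⟩ : ∃ (o : C → C) (b : ∀ X, HalfBraiding (o X)), obj = fun X ↦ ⟨o X, b X⟩ :=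
    ⟨fun X ↦ (obj X).1, fun X ↦ (obj X).2, rfl⟩
  obtain rfl : o = id := funext fun X ↦ Functor.congr_obj hF X
  have hmap {X Y : C} (f : X ⟶ Y) : (map f).f = f := by
    have h := Functor.congr_hom hF f
    exact h.trans ((Category.id_comp _).trans (Category.comp_id f))
  have hb {X Y : C} (f : X ⟶ Y) (U : C) :
      f ▷ U ≫ ((b Y).β U).hom = ((b X).β U).hom ≫ U ◁ f := by
    simpa only [hmap] using (map f).comm U
  refine ⟨b, hb, ?_⟩
  obtain rfl : @map = fun X Y f ↦ ⟨f, hb f⟩ := by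
    funext X Y f
    exact Center.ext _ _ (hmap f)
  rfl

/-- The braiding on `C` given by a family of half-braidings which is natural and compatible
with tensor products in the remaining variable. -/
@[reducible]
def braidedOfHalfBraiding (b : ∀ X : C, HalfBraiding X)
    (hb : ∀ {X Y : C} (f : X ⟶ Y) (U : C),
      f ▷ U ≫ ((b Y).β U).hom = ((b X).β U).hom ≫ U ◁ f)
    (hb_tensor : ∀ X Y U : C, ((b (X ⊗ Y)).β U).hom =
      (α_ X Y U).hom ≫ X ◁ ((b Y).β U).hom ≫ (α_ X U Y).inv ≫
        ((b X).β U).hom ▷ Y ≫ (α_ U X Y).hom) : BraidedCategory C where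
  braiding X Y := (b X).β Y
  braiding_naturality_right X _ _ f := (b X).naturality f
  braiding_naturality_left f Z := hb f Z
  hexagon_forward X Y Z := by simp
  hexagon_reverse X Y Z := by simp [hb_tensor]

theorem liftOfHalfBraiding_ε_μ_f (b : ∀ X : C, HalfBraiding X)
    (hb : ∀ {X Y : C} (f : X ⟶ Y) (U : C),
      f ▷ U ≫ ((b Y).β U).hom = ((b X).β U).hom ≫ U ◁ f)
    (M : (liftOfHalfBraiding b hb).Monoidal)
    (h : (⟨liftOfHalfBraiding b hb ⋙ forget C, inferInstance⟩ : Σ F : C ⥤ C, F.Monoidal) =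
      ⟨𝟭 C, inferInstance⟩) :
    M.ε.f = 𝟙 (𝟙_ C) ∧ ∀ X Y, (M.μ X Y).f = 𝟙 (X ⊗ Y) := by
  have h' := eq_of_heq (Sigma.mk.inj h).2
  constructor
  · have := congr(($h').ε)
    exact (Category.id_comp _).symm.trans this
  · intro X Y
    have := congr(($h').μ X Y)
    exact (Category.id_comp _).symm.trans this

theorem liftOfHalfBraiding_tensor (b : ∀ X : C, HalfBraiding X)
    (hb : ∀ {X Y : C} (f : X ⟶ Y) (U : C),
      f ▷ U ≫ ((b Y).β U).hom = ((b X).β U).hom ≫ U ◁ f)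
    (M : (liftOfHalfBraiding b hb).Monoidal) (hμ : ∀ X Y, (M.μ X Y).f = 𝟙 (X ⊗ Y)) (X Y U : C) :
    ((b (X ⊗ Y)).β U).hom =
      (α_ X Y U).hom ≫ X ◁ ((b Y).β U).hom ≫ (α_ X U Y).inv ≫
        ((b X).β U).hom ▷ Y ≫ (α_ U X Y).hom := by
  have h : 𝟙 (X ⊗ Y) ▷ U ≫ ((b (X ⊗ Y)).β U).hom =
      ((α_ X Y U).hom ≫ X ◁ ((b Y).β U).hom ≫ (α_ X U Y).inv ≫
        ((b X).β U).hom ▷ Y ≫ (α_ U X Y).hom) ≫ U ◁ 𝟙 (X ⊗ Y) := by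
    rw [← hμ X Y]
    exact (M.μ X Y).comm U
  simpa using h

end Center

end CategoryTheory

/-- Braidings on a monoidal category `C` are in bijection with monoidal functors
`ι : C → Z(C)` to the Drinfeld center whose composite with the forgetful functor
`F : Z(C) → C` equals the identity monoidal functor; the braiding `c` corresponds to the
functor `ι_c : X ↦ (X, c_{−,X})`. -/
theorem braidings_equiv_monoidal_sections_of_center_forget
    (C : Type u) [Category.{v} C] [MonoidalCategory C] :
    ∃ e : BraidedCategory C ≃
        {p : Σ F : C ⥤ Center C, F.Monoidal //
          (⟨p.1 ⋙ Center.forget C, by letI := p.2; infer_instance⟩ :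
              Σ F : C ⥤ C, F.Monoidal) = ⟨𝟭 C, inferInstance⟩},
      ∀ b : BraidedCategory C,
        (e b).1 = ⟨@Center.ofBraided C _ _ b, by letI := b; infer_instance⟩ := by
  let Φ (b : BraidedCategory C) :
      {p : Σ F : C ⥤ Center C, F.Monoidal //
          (⟨p.1 ⋙ Center.forget C, by letI := p.2; infer_instance⟩ :
              Σ F : C ⥤ C, F.Monoidal) = ⟨𝟭 C, inferInstance⟩} :=
    ⟨⟨@Center.ofBraided C _ _ b, by letI := b; infer_instance⟩,
      Sigma.ext rfl <| heq_of_eq <| Functor.Monoidal.ext_of_ε_μ _ _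
        (Category.id_comp _) fun _ _ ↦ Category.id_comp _⟩
  refine ⟨Equiv.ofBijective Φ ⟨fun b b' h ↦ ?_, ?_⟩, fun _ ↦ rfl⟩
  · have h := congr_arg (fun p ↦ p.1.1) h
    obtain ⟨β, _⟩ := b
    obtain ⟨β', _⟩ := b'
    obtain rfl : β = β' := by
      funext X Y
      have := eq_of_heq (Sigma.mk.inj (Functor.congr_obj h X)).2
      exact congr(($this).β Y)
    rfl
  · rintro ⟨⟨F, M⟩, h⟩
    obtain ⟨b, hb, rfl⟩ := Center.exists_eq_liftOfHalfBraiding F congr(($h).1)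
    obtain ⟨hε, hμ⟩ := Center.liftOfHalfBraiding_ε_μ_f b hb M h
    refine ⟨Center.braidedOfHalfBraiding b hb (Center.liftOfHalfBraiding_tensor b hb M hμ),
      Subtype.ext <| Sigma.ext rfl <| heq_of_eq <| Functor.Monoidal.ext_of_ε_μ _ _ (Center.ext _ _ hε.symm)
        fun X Y ↦ Center.ext _ _ (hμ X Y).symm⟩
end
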